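/- Suppose the family (R_n)_{n\ge 0} satisfies Assumption R with parameter \beta \ge 0. Then for each coordinate i \in \{0,1,2,3\} and each integer N > s_i there exists C_N > 0 such that for all n \ge 0 and all \xi \in \mathbb{R}^4\setminus\{0\}: |\partial_{\xi_i}\hat{R}_n(\xi)| \le C_N\, 2^{-n s_i}\,\min(|\xi|_s^{-N} 2^{nN},\, 1). -/

import Mathlib

open MeasureTheory Filter Topology

noncomputable section

/-- Parabolic scaling exponents s = (2,1,1,1). -/
def sExp : Fin 4 → ℕ := ![2, 1, 1, 1]

/-- Parabolically scaled norm |z|_s = max_i |z_i|^(1/s_i). -/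
def snorm4 (z : Fin 4 → ℝ) : ℝ := ⨆ i, |z i| ^ ((sExp i : ℝ)⁻¹)

/-- Scaling action l · z = (l^(s_i) z_i)_i. -/
def scl (l : ℝ) (z : Fin 4 → ℝ) : Fin 4 → ℝ := fun i => l ^ (sExp i) * z i

/-- Scaled size |k|_s = ∑ s_i k_i of a multi-index. -/
def ksize (k : Fin 4 → ℕ) : ℝ := ∑ i, (sExp i : ℝ) * (k i : ℝ)

/-- Partial derivative in direction i. -/
def pderiv1 (i : Fin 4) (f : (Fin 4 → ℝ) → ℝ) : (Fin 4 → ℝ) → ℝ :=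
  fun z => fderiv ℝ f z (Pi.single i 1)

/-- Iterated partial derivative ∂^k. -/
def pderivM (k : Fin 4 → ℕ) (f : (Fin 4 → ℝ) → ℝ) : (Fin 4 → ℝ) → ℝ :=
  ((pderiv1 0)^[k 0] ∘ (pderiv1 1)^[k 1] ∘ (pderiv1 2)^[k 2] ∘ (pderiv1 3)^[k 3]) f

/-- Assumption R from the paper: the R_n are even smooth functions, R_n is supported in a
parabolic ball of radius C₀ 2^(-n), the derivative ∂^k R_n is bounded by
C_k 2^(n(|s| + |k|_s - β)) (with |s| = 5), and if β = 0 then R_n integrates to zero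
for n ≥ 1. -/
structure AssumptionR (R : ℕ → (Fin 4 → ℝ) → ℝ) (β : ℝ) : Prop where
  beta_nonneg : 0 ≤ β
  even : ∀ n z, R n (-z) = R n z
  smooth : ∀ n, ContDiff ℝ (⊤ : ℕ∞) (R n)
  support : ∃ C0 > 0, ∀ n z, R n z ≠ 0 → snorm4 z ≤ C0 * (2 : ℝ) ^ (-(n : ℝ))
  deriv_bound : ∀ k : Fin 4 → ℕ, ∃ Ck > 0, ∀ n z,
    |pderivM k (R n) z| ≤ Ck * (2 : ℝ) ^ ((n : ℝ) * (5 + ksize k - β))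
  mean_zero : β = 0 → ∀ n, 1 ≤ n → (∫ z, R n z) = 0

/-- Fourier transform on ℝ⁴ with convention e^(-i⟨ξ,z⟩). -/
def ft (f : (Fin 4 → ℝ) → ℝ) (ξ : Fin 4 → ℝ) : ℂ :=
  ∫ z : Fin 4 → ℝ, Complex.exp (-Complex.I * ((∑ i, ξ i * z i : ℝ) : ℂ)) * (f z : ℂ)

/-- The parabolic annulus A_n^C. -/
def AnC (C : ℝ) (n : ℕ) : Set (Fin 4 → ℝ) :=
  {ξ | C⁻¹ * 2 ^ n ≤ snorm4 ξ ∧ snorm4 ξ ≤ C * 2 ^ n}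

/-- The set B_n^C. -/
def BnC (C : ℝ) (n : ℕ) : Set ((Fin 4 → ℝ) × (Fin 4 → ℝ)) :=
  {p | p.1 ∈ AnC C n ∧ p.2 ∈ AnC C n ∧ p.1 + p.2 ∈ AnC C n}

/-- Integration of a nonnegative function against the measure m̂, given by
(1/2π) ∫ dξ₀ ∑_(k ∈ ℤ³) f(ξ₀, 2πk₁, 2πk₂, 2πk₃). -/
def mIntegral (f : (Fin 4 → ℝ) → ENNReal) : ENNReal :=
  ENNReal.ofReal (1 / (2 * Real.pi)) *
    ∫⁻ t : ℝ, ∑' k : Fin 3 → ℤ, f (Fin.cons t (fun j => 2 * Real.pi * (k j : ℝ)))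

/-- The oscillating kernel of the Fourier transform `ft`. -/
def ftKernel (ξ z : Fin 4 → ℝ) : ℂ :=
  Complex.exp (-Complex.I * ((∑ i, ξ i * z i : ℝ) : ℂ))

lemma ftKernel_comm (ξ z : Fin 4 → ℝ) : ftKernel ξ z = ftKernel z ξ := by
  simp only [ftKernel, mul_comm]

lemma norm_ftKernel (ξ z : Fin 4 → ℝ) : ‖ftKernel ξ z‖ = 1 := by
  rw [ftKernel, neg_mul, mul_comm, ← neg_mul, ← Complex.ofReal_neg,
    Complex.norm_exp_ofReal_mul_I]

lemma continuous_ftKernel (ξ : Fin 4 → ℝ) : Continuous (ftKernel ξ) := by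
  unfold ftKernel
  fun_prop

lemma hasDerivAt_ftKernel_add_smul (ξ z : Fin 4 → ℝ) (j : Fin 4) (t : ℝ) :
    HasDerivAt (fun t : ℝ => ftKernel ξ (z + t • Pi.single j 1))
      (-Complex.I * (ξ j : ℂ) * ftKernel ξ (z + t • Pi.single j 1)) t := by
  have hsum : ∀ t : ℝ, ftKernel ξ (z + t • Pi.single j 1) =
      Complex.exp (-Complex.I * ((∑ i, ξ i * z i + t * ξ j : ℝ) : ℂ)) := by
    intro t
    simp only [ftKernel, Pi.add_apply, Pi.smul_apply, smul_eq_mul, mul_add,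
      Finset.sum_add_distrib]
    congr 3
    simp [Pi.single_apply, mul_comm]
  have hlin : HasDerivAt (fun t : ℝ => ∑ i, ξ i * z i + t * ξ j) (ξ j) t := by
    simpa using ((hasDerivAt_id t).mul_const (ξ j)).const_add (∑ i, ξ i * z i)
  simp only [hsum]
  convert (hlin.ofReal_comp.const_mul (-Complex.I)).cexp using 1
  ring

lemma hasLineDerivAt_ftKernel (ξ z : Fin 4 → ℝ) (j : Fin 4) :
    HasLineDerivAt ℝ (ftKernel ξ) (-Complex.I * (ξ j : ℂ) * ftKernel ξ z) z (Pi.single j 1) := by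
  simpa [HasLineDerivAt] using hasDerivAt_ftKernel_add_smul ξ z j 0

lemma integrable_ftKernel_mul {f : (Fin 4 → ℝ) → ℝ} (hf : Continuous f)
    (hc : HasCompactSupport f) (c : ℂ) (ξ : Fin 4 → ℝ) :
    Integrable fun z => c * ftKernel ξ z * (f z : ℂ) := by
  refine Continuous.integrable_of_hasCompactSupport ?_ ?_
  · exact (continuous_const.mul (continuous_ftKernel ξ)).mul (Complex.continuous_ofReal.comp hf)
  · exact HasCompactSupport.mul_left (hc.comp_left Complex.ofReal_zero)

lemma ContDiff.pderiv1 {f : (Fin 4 → ℝ) → ℝ} (hf : ContDiff ℝ (⊤ : ℕ∞) f) (j : Fin 4) :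
    ContDiff ℝ (⊤ : ℕ∞) (pderiv1 j f) :=
  (hf.fderiv_right (m := (⊤ : ℕ∞)) (by simp)).clm_apply contDiff_const

lemma ContDiff.pderiv1_iterate {f : (Fin 4 → ℝ) → ℝ} (hf : ContDiff ℝ (⊤ : ℕ∞) f)
    (j : Fin 4) (m : ℕ) : ContDiff ℝ (⊤ : ℕ∞) ((_root_.pderiv1 j)^[m] f) := by
  induction m with
  | zero => exact hf
  | succ m ih => rw [Function.iterate_succ_apply']; exact ih.pderiv1 j

lemma tsupport_pderiv1_iterate_subset (f : (Fin 4 → ℝ) → ℝ) (j : Fin 4) (m : ℕ) :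
    tsupport ((pderiv1 j)^[m] f) ⊆ tsupport f := by
  induction m with
  | zero => rfl
  | succ m ih =>
    rw [Function.iterate_succ_apply']
    exact (tsupport_fderiv_apply_subset ℝ _).trans ih

lemma hasLineDerivAt_pderiv1 {f : (Fin 4 → ℝ) → ℝ} (hf : ContDiff ℝ (⊤ : ℕ∞) f)
    (j : Fin 4) (z : Fin 4 → ℝ) : HasLineDerivAt ℝ f (pderiv1 j f z) z (Pi.single j 1) :=
  ((hf.differentiable (by simp)) z).hasFDerivAt.hasLineDerivAt _

lemma ft_pderiv1 {f : (Fin 4 → ℝ) → ℝ} (hf : ContDiff ℝ (⊤ : ℕ∞) f)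
    (hc : HasCompactSupport f) (j : Fin 4) (ξ : Fin 4 → ℝ) :
    ft (pderiv1 j f) ξ = Complex.I * (ξ j : ℂ) * ft f ξ := by
  have hc' : HasCompactSupport (pderiv1 j f) := hc.fderiv_apply ℝ _
  have key := integral_bilinear_hasLineDerivAt_right_eq_neg_left_of_integrable
    (μ := (volume : Measure (Fin 4 → ℝ))) (B := ContinuousLinearMap.mul ℝ ℂ)
    (f := ftKernel ξ) (f' := fun z => -Complex.I * (ξ j : ℂ) * ftKernel ξ z)
    (g := fun z => (f z : ℂ)) (g' := fun z => (pderiv1 j f z : ℂ)) (v := Pi.single j 1)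
    (by simpa using integrable_ftKernel_mul hf.continuous hc (-Complex.I * (ξ j : ℂ)) ξ)
    (by simpa using integrable_ftKernel_mul (hf.pderiv1 j).continuous hc' 1 ξ)
    (by simpa using integrable_ftKernel_mul hf.continuous hc 1 ξ)
    (fun z _ => hasLineDerivAt_ftKernel ξ z j)
    (fun z _ => (hasLineDerivAt_pderiv1 hf j z).ofReal_comp)
  simp only [ContinuousLinearMap.mul_apply'] at key
  change ∫ z, ftKernel ξ z * (pderiv1 j f z : ℂ) =
    Complex.I * (ξ j : ℂ) * ∫ z, ftKernel ξ z * (f z : ℂ)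
  rw [key, ← integral_const_mul, ← integral_neg]
  congr 1 with z
  ring

lemma norm_ft_pderiv1_iterate {f : (Fin 4 → ℝ) → ℝ} (hf : ContDiff ℝ (⊤ : ℕ∞) f)
    (hc : HasCompactSupport f) (j : Fin 4) (m : ℕ) (ξ : Fin 4 → ℝ) :
    ‖ft ((pderiv1 j)^[m] f) ξ‖ = |ξ j| ^ m * ‖ft f ξ‖ := by
  induction m with
  | zero => simp
  | succ m ih =>
    rw [Function.iterate_succ_apply', ft_pderiv1 (hf.pderiv1_iterate j m)
      (hc.of_isClosed_subset (isClosed_tsupport _) (tsupport_pderiv1_iterate_subset f j m)),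
      norm_mul, ih]
    simp
    ring

lemma hasLineDerivAt_ft {f : (Fin 4 → ℝ) → ℝ} (hf : Continuous f)
    (hc : HasCompactSupport f) (i : Fin 4) (ξ : Fin 4 → ℝ) :
    HasLineDerivAt ℝ (ft f) (-Complex.I * ft (fun z => z i * f z) ξ) ξ (Pi.single i 1) := by
  have hf' : Continuous fun z : Fin 4 → ℝ => z i * f z := (continuous_apply i).mul hf
  have hc' : HasCompactSupport fun z : Fin 4 → ℝ => z i * f z := hc.mul_left
  have hderiv : ∀ (z : Fin 4 → ℝ) (t : ℝ),
      HasDerivAt (fun t : ℝ => ftKernel (ξ + t • Pi.single i 1) z * (f z : ℂ))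
        (-Complex.I * ftKernel (ξ + t • Pi.single i 1) z * ((z i * f z : ℝ) : ℂ)) t := by
    intro z t
    simp only [ftKernel_comm _ z]
    refine ((hasDerivAt_ftKernel_add_smul z ξ i t).mul_const (f z : ℂ)).congr_deriv ?_
    push_cast
    ring
  have hmeas : ∀ t : ℝ, AEStronglyMeasurable
      (fun z => ftKernel (ξ + t • Pi.single i 1) z * (f z : ℂ)) volume := fun t => by
    simpa using (integrable_ftKernel_mul hf hc 1 (ξ + t • Pi.single i 1)).aestronglyMeasurable
  have hbound : ∀ (z : Fin 4 → ℝ) (t : ℝ),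
      ‖-Complex.I * ftKernel (ξ + t • Pi.single i 1) z * ((z i * f z : ℝ) : ℂ)‖ ≤
        |z i * f z| := fun z t => by
    rw [norm_mul, norm_mul, norm_ftKernel, Complex.norm_real, norm_neg, Complex.norm_I,
      one_mul, one_mul, Real.norm_eq_abs]
  have key := (hasDerivAt_integral_of_dominated_loc_of_deriv_le
    (F := fun (t : ℝ) z => ftKernel (ξ + t • Pi.single i 1) z * (f z : ℂ))
    (x₀ := (0 : ℝ)) Filter.univ_mem (Eventually.of_forall hmeas)
    (by simpa using integrable_ftKernel_mul hf hc 1 ξ)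
    (integrable_ftKernel_mul hf' hc' _ _).aestronglyMeasurable
    (ae_of_all _ fun z t _ => hbound z t)
    (hf'.integrable_of_hasCompactSupport hc').abs
    (ae_of_all _ fun z t _ => hderiv z t)).2
  have hval : ∫ z, -Complex.I * ftKernel (ξ + (0 : ℝ) • Pi.single i 1) z *
      ((z i * f z : ℝ) : ℂ) = -Complex.I * ft (fun z => z i * f z) ξ := by
    rw [ft, ← integral_const_mul]
    simp only [zero_smul, add_zero, mul_assoc, ftKernel]
  rw [hval] at key
  exact key

lemma norm_fderiv_ft_le {f : (Fin 4 → ℝ) → ℝ} (hf : Continuous f)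
    (hc : HasCompactSupport f) (i : Fin 4) (ξ : Fin 4 → ℝ) :
    ‖fderiv ℝ (ft f) ξ (Pi.single i 1)‖ ≤ ‖ft (fun z => z i * f z) ξ‖ := by
  by_cases hd : DifferentiableAt ℝ (ft f) ξ
  · rw [← hd.lineDeriv_eq_fderiv, (hasLineDerivAt_ft hf hc i ξ).lineDeriv]
    simp
  · simp [fderiv_zero_of_not_differentiableAt hd]

lemma norm_ft_le_of_support_subset {f : (Fin 4 → ℝ) → ℝ} {s : Set (Fin 4 → ℝ)}
    (hs : volume s < ⊤) (hfs : Function.support f ⊆ s) {B : ℝ} (hB : ∀ z, |f z| ≤ B)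
    (ξ : Fin 4 → ℝ) : ‖ft f ξ‖ ≤ B * volume.real s := by
  rw [ft, ← setIntegral_eq_integral_of_forall_compl_eq_zero (s := s)]
  · refine norm_setIntegral_le_of_norm_le_const hs fun z _ => ?_
    have h := norm_ftKernel ξ z
    rw [ftKernel] at h
    rw [norm_mul, h, one_mul, Complex.norm_real]
    exact hB z
  · intro z hz
    have : f z = 0 := by_contra fun h => hz (hfs h)
    simp [this]

lemma pderiv1_iterate_coord_mul {f : (Fin 4 → ℝ) → ℝ} (hf : ContDiff ℝ (⊤ : ℕ∞) f)
    (i j : Fin 4) (m : ℕ) (z : Fin 4 → ℝ) :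
    (pderiv1 j)^[m] (fun z => z i * f z) z = z i * (pderiv1 j)^[m] f z +
      m * (Pi.single j 1 : Fin 4 → ℝ) i * (pderiv1 j)^[m - 1] f z := by
  induction m generalizing z with
  | zero => simp
  | succ m ih =>
    have hd : ∀ k, DifferentiableAt ℝ ((pderiv1 j)^[k] f) z := fun k =>
      (hf.pderiv1_iterate j k).differentiable (by simp) z
    rw [Function.iterate_succ_apply', funext ih, pderiv1]
    have h1 : HasFDerivAt (fun w : Fin 4 → ℝ => w i) (ContinuousLinearMap.proj i) z :=
      (ContinuousLinearMap.proj (R := ℝ) (φ := fun _ : Fin 4 => ℝ) i).hasFDerivAt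
    have h3 := (h1.mul (hd m).hasFDerivAt).add
      ((hd (m - 1)).hasFDerivAt.const_mul (m * (Pi.single j 1 : Fin 4 → ℝ) i))
    rw [HasFDerivAt.fderiv (f := fun x => x i * (pderiv1 j)^[m] f x +
      m * (Pi.single j 1 : Fin 4 → ℝ) i * (pderiv1 j)^[m - 1] f x) h3]
    have h2 : ∀ k, fderiv ℝ ((pderiv1 j)^[k] f) z (Pi.single j 1) = (pderiv1 j)^[k + 1] f z := by
      intro k
      rw [Function.iterate_succ_apply', pderiv1]
    simp [h2]
    rcases m with _ | m
    · simp; ring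
    · simp; ring

lemma pderivM_single (j : Fin 4) (m : ℕ) (f : (Fin 4 → ℝ) → ℝ) :
    pderivM (Pi.single j m) f = (pderiv1 j)^[m] f := by
  fin_cases j <;> simp [pderivM]

lemma ksize_single (j : Fin 4) (m : ℕ) : ksize (Pi.single j m) = sExp j * m := by
  simp [ksize, Pi.single_apply]

lemma sExp_pos (j : Fin 4) : 0 < sExp j := by
  fin_cases j <;> simp [sExp]

lemma abs_rpow_le_snorm4 (z : Fin 4 → ℝ) (i : Fin 4) :
    |z i| ^ ((sExp i : ℝ)⁻¹) ≤ snorm4 z :=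
  le_ciSup (f := fun i => |z i| ^ ((sExp i : ℝ)⁻¹)) (Set.finite_range _).bddAbove i

lemma rpow_inv_sExp_pow {x : ℝ} (hx : 0 ≤ x) (i : Fin 4) :
    (x ^ ((sExp i : ℝ)⁻¹)) ^ sExp i = x :=
  Real.rpow_inv_natCast_pow hx (sExp_pos i).ne'

lemma abs_le_snorm4_pow (z : Fin 4 → ℝ) (i : Fin 4) : |z i| ≤ snorm4 z ^ sExp i := by
  rw [← rpow_inv_sExp_pow (abs_nonneg (z i)) i]
  exact pow_le_pow_left₀ (by positivity) (abs_rpow_le_snorm4 z i) _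

lemma exists_snorm4_pow_eq (z : Fin 4 → ℝ) : ∃ j, snorm4 z ^ sExp j = |z j| := by
  obtain ⟨j, hj⟩ := exists_eq_ciSup_of_finite (f := fun i => |z i| ^ ((sExp i : ℝ)⁻¹))
  exact ⟨j, by rw [snorm4, ← hj, rpow_inv_sExp_pow (abs_nonneg _)]⟩

lemma snorm4_pos {z : Fin 4 → ℝ} (hz : z ≠ 0) : 0 < snorm4 z := by
  obtain ⟨i, hi⟩ := Function.ne_iff.1 hz
  exact (Real.rpow_pos_of_pos (abs_pos.2 hi) _).trans_le (abs_rpow_le_snorm4 z i)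

/-- The closed box with half-side `r ^ sExp i` in direction `i`. -/
def parabolicBox (r : ℝ) : Set (Fin 4 → ℝ) :=
  Set.Icc (fun i => -r ^ sExp i) (fun i => r ^ sExp i)

lemma mem_parabolicBox_iff {r : ℝ} {z : Fin 4 → ℝ} :
    z ∈ parabolicBox r ↔ ∀ i, |z i| ≤ r ^ sExp i := by
  simp [parabolicBox, Pi.le_def, abs_le, forall_and]

lemma volume_real_parabolicBox {r : ℝ} (hr : 0 ≤ r) :
    volume.real (parabolicBox r) = 16 * r ^ 5 := by
  rw [Measure.real, parabolicBox, Real.volume_Icc_pi_toReal]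
  · simp [Fin.prod_univ_four, sExp]; ring
  · intro i
    have : 0 ≤ r ^ sExp i := by positivity
    simp only; linarith

lemma isCompact_parabolicBox (r : ℝ) : IsCompact (parabolicBox r) := isCompact_Icc

lemma AssumptionR.exists_tsupport_subset {R : ℕ → (Fin 4 → ℝ) → ℝ} {β : ℝ}
    (hR : AssumptionR R β) :
    ∃ c > 0, ∀ n, tsupport (R n) ⊆ parabolicBox (c / 2 ^ n) := by
  obtain ⟨c, hc, h⟩ := hR.support
  refine ⟨c, hc, fun n => closure_minimal (fun z hz => ?_) (isCompact_parabolicBox _).isClosed⟩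
  have hz' := h n z hz
  rw [Real.rpow_neg (by norm_num), Real.rpow_natCast, ← div_eq_mul_inv] at hz'
  have h0 : 0 ≤ snorm4 z := Real.iSup_nonneg fun i => by positivity
  exact mem_parabolicBox_iff.2 fun i =>
    (abs_le_snorm4_pow z i).trans (pow_le_pow_left₀ h0 hz' _)

lemma AssumptionR.exists_pderiv1_iterate_bound {R : ℕ → (Fin 4 → ℝ) → ℝ} {β : ℝ}
    (hR : AssumptionR R β) (j : Fin 4) (m : ℕ) :
    ∃ K > 0, ∀ n z, |(pderiv1 j)^[m] (R n) z| ≤ K * ((2 ^ n) ^ 5 * (2 ^ n) ^ (sExp j * m)) := by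
  obtain ⟨K, hK, h⟩ := hR.deriv_bound (Pi.single j m)
  refine ⟨K, hK, fun n z => ?_⟩
  rw [← pderivM_single]
  refine (h n z).trans (mul_le_mul_of_nonneg_left ?_ hK.le)
  rw [ksize_single, ← pow_add, ← pow_mul, ← Real.rpow_natCast]
  refine Real.rpow_le_rpow_of_exponent_le (by norm_num) ?_
  push_cast
  exact mul_le_mul_of_nonneg_left (by linarith [hR.beta_nonneg]) n.cast_nonneg

lemma AssumptionR.exists_pderiv1_iterate_coord_mul_bound {R : ℕ → (Fin 4 → ℝ) → ℝ} {β : ℝ}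
    (hR : AssumptionR R β) (i j : Fin 4) (m : ℕ) :
    ∃ K > 0, ∀ n z, |(pderiv1 j)^[m] (fun z => z i * R n z) z| ≤
      K * ((2 ^ n) ^ 5 * (2 ^ n) ^ (sExp j * m) / (2 ^ n) ^ sExp i) := by
  obtain ⟨c, hc, hsupp⟩ := hR.exists_tsupport_subset
  obtain ⟨K₁, hK₁, h₁⟩ := hR.exists_pderiv1_iterate_bound j m
  obtain ⟨K₂, hK₂, h₂⟩ := hR.exists_pderiv1_iterate_bound j (m - 1)
  refine ⟨c ^ sExp i * K₁ + m * K₂, by positivity, fun n z => ?_⟩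
  have hfirst : |z i * (pderiv1 j)^[m] (R n) z| ≤
      c ^ sExp i * K₁ * ((2 ^ n) ^ 5 * (2 ^ n) ^ (sExp j * m) / (2 ^ n) ^ sExp i) := by
    by_cases hz : z ∈ tsupport ((pderiv1 j)^[m] (R n))
    · have hzi := mem_parabolicBox_iff.1
        (hsupp n (tsupport_pderiv1_iterate_subset (R n) j m hz)) i
      rw [abs_mul]
      refine (mul_le_mul hzi (h₁ n z) (abs_nonneg _) (by positivity)).trans_eq ?_
      rw [div_pow]
      ring
    · rw [image_eq_zero_of_notMem_tsupport hz, mul_zero, abs_zero]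
      positivity
  have hsecond : |m * (Pi.single j 1 : Fin 4 → ℝ) i * (pderiv1 j)^[m - 1] (R n) z| ≤
      m * K₂ * ((2 ^ n) ^ 5 * (2 ^ n) ^ (sExp j * m) / (2 ^ n) ^ sExp i) := by
    rcases eq_or_ne i j with rfl | hij
    · rcases m with _ | m
      · simp
      · rw [Pi.single_eq_same, mul_one, abs_mul, Nat.abs_cast, mul_assoc, mul_add_one, pow_add]
        refine mul_le_mul_of_nonneg_left ((h₂ n z).trans_eq ?_) (Nat.cast_nonneg _)
        rw [Nat.add_sub_cancel]
        field_simp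
    · rw [Pi.single_eq_of_ne hij, mul_zero, zero_mul, abs_zero]
      positivity
  rw [pderiv1_iterate_coord_mul (hR.smooth n), add_mul]
  exact (abs_add_le _ _).trans (add_le_add hfirst hsecond)

lemma AssumptionR.exists_abs_pow_mul_norm_fderiv_ft_le {R : ℕ → (Fin 4 → ℝ) → ℝ} {β : ℝ}
    (hR : AssumptionR R β) (i j : Fin 4) (m : ℕ) :
    ∃ K > 0, ∀ (n : ℕ) (ξ : Fin 4 → ℝ),
      |ξ j| ^ m * ‖fderiv ℝ (ft (R n)) ξ (Pi.single i 1)‖ ≤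
        K * ((2 ^ n) ^ (sExp j * m) / (2 ^ n) ^ sExp i) := by
  obtain ⟨c, hc, hsupp⟩ := hR.exists_tsupport_subset
  obtain ⟨K, hK, h⟩ := hR.exists_pderiv1_iterate_coord_mul_bound i j m
  refine ⟨K * (16 * c ^ 5), by positivity, fun n ξ => ?_⟩
  have hbox := isCompact_parabolicBox (c / 2 ^ n)
  have hcs : HasCompactSupport (R n) := hbox.of_isClosed_subset (isClosed_tsupport _) (hsupp n)
  have hcs' : HasCompactSupport fun z => z i * R n z := hcs.mul_left
  have hsm : ContDiff ℝ (⊤ : ℕ∞) fun z : Fin 4 → ℝ => z i * R n z :=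
    (contDiff_apply ℝ ℝ i).mul (hR.smooth n)
  have hsub : Function.support ((pderiv1 j)^[m] fun z => z i * R n z) ⊆
      parabolicBox (c / 2 ^ n) :=
    (subset_tsupport _).trans ((tsupport_pderiv1_iterate_subset _ j m).trans
      ((tsupport_mul_subset_right (f := fun z : Fin 4 → ℝ => z i)).trans (hsupp n)))
  calc |ξ j| ^ m * ‖fderiv ℝ (ft (R n)) ξ (Pi.single i 1)‖
      ≤ |ξ j| ^ m * ‖ft (fun z => z i * R n z) ξ‖ := by
        gcongr
        exact norm_fderiv_ft_le (hR.smooth n).continuous hcs i ξ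
    _ = ‖ft ((pderiv1 j)^[m] fun z => z i * R n z) ξ‖ :=
        (norm_ft_pderiv1_iterate hsm hcs' j m ξ).symm
    _ ≤ K * ((2 ^ n) ^ 5 * (2 ^ n) ^ (sExp j * m) / (2 ^ n) ^ sExp i) *
          (16 * (c / 2 ^ n) ^ 5) := by
        rw [← volume_real_parabolicBox (by positivity)]
        exact norm_ft_le_of_support_subset hbox.measure_lt_top hsub (h n) ξ
    _ = _ := by
        field_simp

/-- bound from the proof of Lemma 2.4.  Under Assumption R, for each
coordinate i and each integer N > sᵢ, uniformly in n and ξ ≠ 0,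
|∂_(ξᵢ) R̂ₙ(ξ)| ≲ 2^(-n sᵢ) min(|ξ|_s^(-N) 2^(nN), 1). -/
theorem stmt12 (R : ℕ → (Fin 4 → ℝ) → ℝ) (β : ℝ) (hR : AssumptionR R β) :
    ∀ i : Fin 4, ∀ N : ℕ, (sExp i : ℝ) < N →
      ∃ C > 0, ∀ n : ℕ, ∀ ξ : Fin 4 → ℝ, ξ ≠ 0 →
        ‖fderiv ℝ (ft (R n)) ξ (Pi.single i 1)‖ ≤
          C * (2 : ℝ) ^ (-(n : ℝ) * (sExp i : ℝ)) *
            min (snorm4 ξ ^ (-(N : ℝ)) * (2 : ℝ) ^ ((n : ℝ) * N)) 1 := by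
  intro i N _
  choose K hK hbound using fun j => hR.exists_abs_pow_mul_norm_fderiv_ft_le i j N
  obtain ⟨K₀, hK₀, hbound₀⟩ := hR.exists_abs_pow_mul_norm_fderiv_ft_le i 0 0
  refine ⟨K₀ + ∑ j, K j, add_pos_of_pos_of_nonneg hK₀ (Finset.sum_nonneg fun j _ => (hK j).le),
    fun n ξ hξ => ?_⟩
  have hsum : 0 ≤ ∑ j, K j := Finset.sum_nonneg fun j _ => (hK j).le
  have hx : 0 < snorm4 ξ := snorm4_pos hξ
  have e1 : (2 : ℝ) ^ (-(n : ℝ) * (sExp i : ℝ)) = 1 / (2 ^ n) ^ sExp i := by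
    rw [neg_mul, Real.rpow_neg (by norm_num), one_div, Real.rpow_mul (by norm_num),
      Real.rpow_natCast, Real.rpow_natCast]
  have e2 : snorm4 ξ ^ (-(N : ℝ)) * (2 : ℝ) ^ ((n : ℝ) * N) = (2 ^ n / snorm4 ξ) ^ N := by
    rw [Real.rpow_neg hx.le, Real.rpow_mul (by norm_num), Real.rpow_natCast, Real.rpow_natCast,
      Real.rpow_natCast, div_pow, div_eq_inv_mul]
  rw [e1, e2]
  generalize hD : ‖fderiv ℝ (ft (R n)) ξ (Pi.single i 1)‖ = D at *
  have hD₀ : D ≤ K₀ * (1 / (2 ^ n) ^ sExp i) := by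
    simpa [hD] using hbound₀ n ξ
  rcases le_total (snorm4 ξ) (2 ^ n) with hle | hle
  · rw [min_eq_right (one_le_pow₀ ((one_le_div hx).2 hle)), mul_one]
    refine hD₀.trans ?_
    gcongr
    linarith
  · rw [min_eq_left (pow_le_one₀ (by positivity) ((div_le_one hx).2 hle))]
    obtain ⟨j, hj⟩ := exists_snorm4_pow_eq ξ
    have hb := hbound j n ξ
    rw [hD, ← hj, ← pow_mul] at hb
    have hDj : D ≤ K j * (1 / (2 ^ n) ^ sExp i) * (2 ^ n / snorm4 ξ) ^ (sExp j * N) := by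
      rw [div_pow, ← mul_div_assoc, le_div_iff₀ (by positivity)]
      calc D * snorm4 ξ ^ (sExp j * N) = snorm4 ξ ^ (sExp j * N) * D := mul_comm _ _
        _ ≤ _ := hb
        _ = _ := by ring
    refine hDj.trans ?_
    have hKj : K j ≤ K₀ + ∑ j, K j := by
      have := Finset.single_le_sum (fun j _ => (hK j).le) (Finset.mem_univ j)
      linarith
    have hpow : (2 ^ n / snorm4 ξ) ^ (sExp j * N) ≤ (2 ^ n / snorm4 ξ) ^ N :=
      pow_le_pow_of_le_one (by positivity) ((div_le_one hx).2 hle)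
        (Nat.le_mul_of_pos_left N (sExp_pos j))
    gcongr
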